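/- Let r and r' be applicable rules (r ≠ r') whose head literals H(r) and H(r') are strongly complementary. Then r and r' are non-conflicting if and only if there exist extended literals e ∈ B(r) and e' ∈ B(r') such that e and e' are conflict-preventing, i.e., e and e' are atom-related and complementary (strongly complementary or default complementary). -/

import Mathlib

/-! ## Classical and extended literals -/

/-- A classical literal over atoms `A`: an atom `a` (positive) or a strongly
negated atom `¬a` (negative). -/
inductive CLit (A : Type) : Type
  | pos : A → CLit A
  | neg : A → CLit A
deriving DecidableEq

namespace CLit

/-- The strong complement of a classical literal. -/
def compl {A : Type} : CLit A → CLit A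
  | pos a => neg a
  | neg a => pos a

/-- The underlying atom of a classical literal. -/
def atom {A : Type} : CLit A → A
  | pos a => a
  | neg a => a

end CLit

/-- Two classical literals are strongly complementary. -/
def StronglyComp {A : Type} (L L' : CLit A) : Prop := L' = L.compl

/-- A set of classical literals is consistent iff it contains no strongly
complementary pair. -/
def Consistent {A : Type} (S : Set (CLit A)) : Prop := ∀ L ∈ S, L.compl ∉ S

/-- An extended literal: a classical literal `L` or a default-negated
classical literal `not L`. -/
inductive ELit (A : Type) : Type
  | lit : CLit A → ELit A
  | not : CLit A → ELit A
deriving DecidableEq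

namespace ELit

/-- The underlying atom of an extended literal. -/
def atom {A : Type} : ELit A → A
  | lit L => L.atom
  | not L => L.atom

end ELit

/-- Two extended literals are atom-related iff they have the same underlying atom. -/
def AtomRelated {A : Type} (e e' : ELit A) : Prop := e.atom = e'.atom

/-- Strongly complementary extended literals: `L` and its strong complement. -/
def EStrComp {A : Type} (e e' : ELit A) : Prop :=
  ∃ L : CLit A, e = ELit.lit L ∧ e' = ELit.lit L.compl

/-- Default complementary extended literals: `L` and `not L`. -/
def EDefComp {A : Type} (e e' : ELit A) : Prop :=
  ∃ L : CLit A, (e = ELit.lit L ∧ e' = ELit.not L) ∨ (e = ELit.not L ∧ e' = ELit.lit L)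

/-- Complementary extended literals: strongly or default complementary. -/
def EComp {A : Type} (e e' : ELit A) : Prop := EStrComp e e' ∨ EDefComp e e'

/-- Dual extended literals: `L` and `not (strong complement of L)`. -/
def EDual {A : Type} (e e' : ELit A) : Prop :=
  ∃ L : CLit A, (e = ELit.lit L ∧ e' = ELit.not L.compl) ∨ (e = ELit.not L.compl ∧ e' = ELit.lit L)

/-- Reconcilable extended literals: `not L` and `not (strong complement of L)`. -/
def EReconc {A : Type} (e e' : ELit A) : Prop :=
  ∃ L : CLit A, e = ELit.not L ∧ e' = ELit.not L.compl

/-- Satisfaction of an extended literal by a set of classical literals: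
`S ⊨ L` iff `L ∈ S`, and `S ⊨ not L` iff `L ∉ S`. -/
def SatE {A : Type} (S : Set (CLit A)) : ELit A → Prop
  | ELit.lit L => L ∈ S
  | ELit.not L => L ∉ S

/-- A set `S` of classical literals satisfies a set `X` of extended literals
iff it satisfies every element of `X`. -/
def SatAll {A : Type} (S : Set (CLit A)) (X : Set (ELit A)) : Prop := ∀ e ∈ X, SatE S e

/-! ## Rules and programs -/

/-- A rule: a head (a classical literal) and a finite body of extended literals. -/
structure Rule (A : Type) where
  head : CLit A
  body : Finset (ELit A)

/-- The classical literals occurring positively in the body, `B⁺(r)`. -/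
def Rule.bodyPos {A : Type} (r : Rule A) : Set (CLit A) := {L | ELit.lit L ∈ r.body}

/-- The classical literals occurring default-negated in the body, `B⁻(r)`. -/
def Rule.bodyNeg {A : Type} (r : Rule A) : Set (CLit A) := {L | ELit.not L ∈ r.body}

/-- A rule is applicable iff some consistent set of classical literals
satisfies its body. -/
def Applicable {A : Type} (r : Rule A) : Prop :=
  ∃ S : Set (CLit A), Consistent S ∧ SatAll S ↑r.body

/-- Two rules `r ≠ r'` are conflicting iff their heads are strongly complementary
and some consistent set of classical literals satisfies both bodies. -/
def Conflicting {A : Type} (r r' : Rule A) : Prop :=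
  r ≠ r' ∧ StronglyComp r.head r'.head ∧
    ∃ S : Set (CLit A), Consistent S ∧ SatAll S ↑r.body ∧ SatAll S ↑r'.body

/-! ## Answer set semantics -/

/-- `S` is a model of the positive parts: for each rule, the head is in `S`
whenever the positive body is contained in `S`. -/
def PModel {A : Type} (P : Set (Rule A)) (S : Set (CLit A)) : Prop :=
  ∀ r ∈ P, r.bodyPos ⊆ S → r.head ∈ S

/-- The least model of a program without default negation. -/
def leastModel {A : Type} (P : Set (Rule A)) : Set (CLit A) := ⋂₀ {S | PModel P S}

open Classical in
/-- The answer set of a program without default negation: the least model if it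
is consistent, and the set `Lit_A` of all classical literals otherwise. -/
noncomputable def posAnswerSet {A : Type} (P : Set (Rule A)) : Set (CLit A) :=
  if Consistent (leastModel P) then leastModel P else Set.univ

/-- Whether an extended literal is a (positive occurrence of a) classical literal. -/
def ELit.isPos {A : Type} : ELit A → Bool
  | ELit.lit _ => true
  | ELit.not _ => false

/-- The reduct `P^S`: keep the rules with `B⁻(r) ∩ S = ∅`, as `H(r) ← B⁺(r)`. -/
def reduct {A : Type} (P : Set (Rule A)) (S : Set (CLit A)) : Set (Rule A) :=
  {r' | ∃ r ∈ P, r.bodyNeg ∩ S = ∅ ∧ r' = ⟨r.head, r.body.filter (fun e => e.isPos)⟩}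

/-- `S` is an answer set of `P` iff `S` is the answer set of the reduct `P^S`. -/
def AnswerSet {A : Type} (P : Set (Rule A)) (S : Set (CLit A)) : Prop :=
  S = posAnswerSet (reduct P S)

/-- The fact corresponding to a classical literal: a rule with empty body. -/
def fact {A : Type} (L : CLit A) : Rule A := ⟨L, ∅⟩

/-! ## Blankets and the negation operator -/

/-- The adversarial rules of `r` in the program `P`. -/
def Adv {A : Type} (P : Set (Rule A)) (r : Rule A) : Set (Rule A) :=
  {r' ∈ P | Conflicting r r'}

/-- The negation operator on extended literals:
`neg a = {not a, ¬a}`, `neg ¬a = {not ¬a, a}`, `neg (not a) = {a}`, `neg (not ¬a) = {¬a}`. -/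
def negE {A : Type} : ELit A → Set (ELit A)
  | ELit.lit L => {ELit.not L, ELit.lit L.compl}
  | ELit.not L => {ELit.lit L}

/-- `neg(e, X) = ⋂ {neg k : k ∈ X, k atom-related to e}`. -/
def negDep {A : Type} (e : ELit A) (X : Set (ELit A)) : Set (ELit A) :=
  ⋂ k ∈ {k ∈ X | AtomRelated k e}, negE k

/-- `Neg(X)`: all sets `T` of extended literals containing exactly one element of
each nonempty set `neg(e, X)` for `e ∈ X`, and nothing else. -/
def NegSets {A : Type} (X : Set (ELit A)) : Set (Set (ELit A)) :=
  {T | (∀ e ∈ X, (negDep e X).Nonempty → ∃! t, t ∈ T ∧ t ∈ negDep e X) ∧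
       (∀ t ∈ T, ∃ e ∈ X, t ∈ negDep e X)}

/-- All blanket conditions except `⊆`-minimality: nonempty, no complementary pair,
no reconcilable pair, atoms disjoint from the atoms of `B(r)`, and meeting the body
of every adversarial rule of `r`. -/
def PreBlanket {A : Type} (P : Set (Rule A)) (r : Rule A) (β : Set (ELit A)) : Prop :=
  β.Nonempty ∧
  (∀ e ∈ β, ∀ e' ∈ β, ¬ EComp e e') ∧
  (∀ e ∈ β, ∀ e' ∈ β, ¬ EReconc e e') ∧
  (∀ e ∈ β, ∀ e' ∈ r.body, e.atom ≠ ELit.atom e') ∧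
  (∀ rj ∈ Adv P r, ∃ e ∈ β, e ∈ rj.body)

/-- A blanket for `Adv(r)` (with ambient program `P`): a `⊆`-minimal set
satisfying the blanket conditions. -/
def Blanket {A : Type} (P : Set (Rule A)) (r : Rule A) (β : Set (ELit A)) : Prop :=
  PreBlanket P r β ∧ ∀ β' ⊆ β, PreBlanket P r β' → β' = β

theorem CLit.compl_compl {A : Type} (L : CLit A) : L.compl.compl = L := by
  cases L <;> rfl

theorem CLit.atom_compl {A : Type} (L : CLit A) : L.compl.atom = L.atom := by
  cases L <;> rfl

theorem EComp.symm {A : Type} {e e' : ELit A} (h : EComp e e') : EComp e' e := by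
  rcases h with ⟨L, rfl, rfl⟩ | ⟨L, ⟨rfl, rfl⟩ | ⟨rfl, rfl⟩⟩
  · exact Or.inl ⟨L.compl, rfl, by rw [CLit.compl_compl]⟩
  · exact Or.inr ⟨L, Or.inr ⟨rfl, rfl⟩⟩
  · exact Or.inr ⟨L, Or.inl ⟨rfl, rfl⟩⟩

theorem EComp.atomRelated {A : Type} {e e' : ELit A} (h : EComp e e') : AtomRelated e e' := by
  rcases h with ⟨L, rfl, rfl⟩ | ⟨L, ⟨rfl, rfl⟩ | ⟨rfl, rfl⟩⟩
  · exact L.atom_compl.symm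
  · rfl
  · rfl

/-- A consistent set satisfies no two complementary extended literals. -/
theorem EComp.not_satE {A : Type} {S : Set (CLit A)} (hS : Consistent S) {e e' : ELit A}
    (h : EComp e e') (he : SatE S e) : ¬ SatE S e' := by
  rcases h with ⟨L, rfl, rfl⟩ | ⟨L, ⟨rfl, rfl⟩ | ⟨rfl, rfl⟩⟩
  · exact hS L he
  · exact fun h => h he
  · exact he

/-- The body of an applicable rule contains no complementary pair. -/
theorem Applicable.not_eComp {A : Type} {r : Rule A} (h : Applicable r) {e e' : ELit A}
    (he : e ∈ r.body) (he' : e' ∈ r.body) : ¬ EComp e e' := by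
  obtain ⟨S, hS, hsat⟩ := h
  exact fun hc => hc.not_satE hS (hsat e he) (hsat e' he')

/-- A set of extended literals without complementary pairs is satisfied by a consistent set,
namely the set of its positive elements. -/
theorem exists_consistent_satAll {A : Type} {X : Set (ELit A)}
    (hX : ∀ e ∈ X, ∀ e' ∈ X, ¬ EComp e e') :
    ∃ S : Set (CLit A), Consistent S ∧ SatAll S X := by
  refine ⟨{L | ELit.lit L ∈ X}, fun L hL hL' => hX _ hL _ hL' (Or.inl ⟨L, rfl, rfl⟩), ?_⟩
  rintro (L | L) he
  · exact he
  · exact fun hL => hX _ hL _ he (Or.inr ⟨L, Or.inl ⟨rfl, rfl⟩⟩)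

/-- Two applicable rules `r ≠ r'` with strongly complementary heads
are non-conflicting iff there are extended literals `e ∈ B(r)` and `e' ∈ B(r')` that
are conflict-preventing, i.e. atom-related and complementary. -/
theorem stmt_2 {A : Type} (r r' : Rule A) (hne : r ≠ r')
    (hH : StronglyComp r.head r'.head)
    (happ : Applicable r) (happ' : Applicable r') :
    ¬ Conflicting r r' ↔
      ∃ e ∈ r.body, ∃ e' ∈ r'.body, AtomRelated e e' ∧ EComp e e' := by
  constructor
  · intro hnc
    by_contra! hno
    have hcross : ∀ e ∈ r.body, ∀ e' ∈ r'.body, ¬ EComp e e' :=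
      fun e he e' he' hc => hno e he e' he' hc.atomRelated hc
    obtain ⟨S, hS, hsat⟩ := exists_consistent_satAll
      (X := (↑r.body : Set (ELit A)) ∪ ↑r'.body) (by
        rintro e (he | he) e' (he' | he')
        · exact happ.not_eComp he he'
        · exact hcross e he e' he'
        · exact fun hc => hcross e' he' e he hc.symm
        · exact happ'.not_eComp he he')
    exact hnc ⟨hne, hH, S, hS, fun e he => hsat e (Or.inl he), fun e he => hsat e (Or.inr he)⟩
  · rintro ⟨e, he, e', he', -, hc⟩ ⟨-, -, S, hS, hr, hr'⟩
    exact hc.not_satE hS (hr e he) (hr' e' he')
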